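/- arXiv:0801.0820 — 2 statements merged into one kernel-verified Lean document; each statement's English description precedes it below -/
import Mathlib

section
/- Let A → B be a local morphism of Noetherian local rings, k the residue field of A, and M, N finitely generated B-modules with N flat over A. For a B-module morphism u : M → N, the following are equivalent: (i) u is injective and Coker(u) is flat over A; (ii) the induced map u ⊗ 1 : M ⊗_A k → N ⊗_A k is injective. -/
/-!
STATEMENT 0 (EGA III 10.2.4): Let `A → B` be a local morphism of Noetherian local rings,
`k` the residue field of `A`, and `M`, `N` finitely generated `B`-modules with `N` flat
over `A`.  For a `B`-module morphism `u : M → N`, the following are equivalent: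
(i) `u` is injective and `Coker u` is flat over `A`;
(ii) `u ⊗ 1 : M ⊗_A k → N ⊗_A k` is injective.
-/

open IsLocalRing

open TensorProduct

/-- The property of being injective after tensoring is stable under extensions of the auxiliary
module, when the target is flat. -/
theorem LinearMap.lTensor_injective_of_extension
    {A M N P : Type*} [CommRing A]
    [AddCommGroup M] [Module A M] [AddCommGroup N] [Module A N] [Module.Flat A N]
    [AddCommGroup P] [Module A P] (Q : Submodule A P) (u : M →ₗ[A] N)
    (hsub : Function.Injective (u.lTensor Q)) (hquot : Function.Injective (u.lTensor (P ⧸ Q))) :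
    Function.Injective (u.lTensor P) := by
  rw [injective_iff_map_eq_zero]
  intro x hx
  have hx' : Q.mkQ.rTensor M x = 0 := by
    apply hquot
    rw [map_zero, ← LinearMap.comp_apply, LinearMap.lTensor_comp_rTensor,
      ← LinearMap.rTensor_comp_lTensor, LinearMap.comp_apply, hx, map_zero]
  obtain ⟨y, rfl⟩ :=
    (rTensor_exact M (LinearMap.exact_subtype_mkQ Q) Q.mkQ_surjective x).mp hx'
  have hy : u.lTensor Q y = 0 := by
    apply Module.Flat.rTensor_preserves_injective_linearMap (M := N) Q.subtype
      Q.subtype_injective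
    rw [map_zero, ← LinearMap.comp_apply, LinearMap.rTensor_comp_lTensor,
      ← LinearMap.lTensor_comp_rTensor, LinearMap.comp_apply, hx]
  rw [(injective_iff_map_eq_zero _).mp hsub y hy, map_zero]

namespace IsLocalRing

theorem lTensor_injective_of_residueField_module
    {A M N P : Type*} [CommRing A] [IsLocalRing A]
    [AddCommGroup M] [Module A M] [AddCommGroup N] [Module A N]
    [AddCommGroup P] [Module A P] [Module (ResidueField A) P] [IsScalarTower A (ResidueField A) P]
    (u : M →ₗ[A] N) (hu : Function.Injective (u.lTensor (ResidueField A))) :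
    Function.Injective (u.lTensor P) := by
  have h : Function.Injective ((u.baseChange (ResidueField A)).lTensor P) :=
    Module.Flat.lTensor_preserves_injective_linearMap _ hu
  let eM := AlgebraTensorModule.cancelBaseChange A (ResidueField A) (ResidueField A) P M
  let eN := AlgebraTensorModule.cancelBaseChange A (ResidueField A) (ResidueField A) P N
  have hcomm : ∀ x, u.lTensor P x = eN ((u.baseChange (ResidueField A)).lTensor P (eM.symm x)) := by
    intro x
    induction x with
    | zero => simp
    | add x y hx hy => simp only [map_add, hx, hy]
    | tmul p m => simp [eM, eN]
  intro x y hxy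
  rw [hcomm, hcomm] at hxy
  exact eM.symm.injective (h (eN.injective hxy))

theorem lTensor_injective_of_maximalIdeal_pow_smul_eq_zero
    {A M N : Type*} [CommRing A] [IsLocalRing A]
    [AddCommGroup M] [Module A M] [AddCommGroup N] [Module A N] [Module.Flat A N]
    (u : M →ₗ[A] N) (hu : Function.Injective (u.lTensor (ResidueField A))) (n : ℕ)
    {P : Type*} [AddCommGroup P] [Module A P]
    (hP : ∀ a ∈ maximalIdeal A ^ n, ∀ p : P, a • p = 0) :
    Function.Injective (u.lTensor P) := by
  induction n generalizing P with
  | zero =>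
    have : Subsingleton P := subsingleton_of_forall_eq 0 fun p ↦ by
      simpa using hP 1 (by simp) p
    exact Function.injective_of_subsingleton _
  | succ n ih =>
    refine u.lTensor_injective_of_extension (maximalIdeal A • ⊤ : Submodule A P) (ih ?_) ?_
    · rintro a ha ⟨p, hp⟩
      ext
      change a • p = 0
      induction hp using Submodule.smul_induction_on' with
      | smul b hb q _ => rw [← mul_smul]; exact hP _ (pow_succ (maximalIdeal A) n ▸
          Ideal.mul_mem_mul ha hb) q
      | add x _ y _ hx hy => rw [smul_add, hx, hy, add_zero]
    · let _ : Module (ResidueField A) (P ⧸ (maximalIdeal A • ⊤ : Submodule A P)) :=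
        inferInstanceAs (Module (A ⧸ maximalIdeal A) (P ⧸ (maximalIdeal A • ⊤ : Submodule A P)))
      have _ : IsScalarTower A (ResidueField A) (P ⧸ (maximalIdeal A • ⊤ : Submodule A P)) :=
        inferInstanceAs
          (IsScalarTower A (A ⧸ maximalIdeal A) (P ⧸ (maximalIdeal A • ⊤ : Submodule A P)))
      exact lTensor_injective_of_residueField_module u hu

end IsLocalRing

theorem Module.Finite.tensorProduct_restrictScalars
    (A B M P : Type*) [CommRing A] [CommRing B] [Algebra A B]
    [AddCommGroup M] [Module A M] [Module B M] [IsScalarTower A B M] [Module.Finite B M]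
    [AddCommGroup P] [Module A P] [Module.Finite A P] :
    Module.Finite B (M ⊗[A] P) :=
  .equiv (AlgebraTensorModule.cancelBaseChange A B B M P)

theorem TensorProduct.mem_map_smul_top_of_lTensor_mkQ_eq_zero
    {A B M P : Type*} [CommRing A] [CommRing B] [Algebra A B]
    [AddCommGroup M] [Module A M] [Module B M] [IsScalarTower A B M]
    [AddCommGroup P] [Module A P] (I : Ideal A) (x : M ⊗[A] P)
    (hx : (I • ⊤ : Submodule A P).mkQ.lTensor M x = 0) :
    x ∈ (I.map (algebraMap A B) • ⊤ : Submodule B (M ⊗[A] P)) := by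
  obtain ⟨y, rfl⟩ :=
    (lTensor_exact M (LinearMap.exact_subtype_mkQ _) (Submodule.mkQ_surjective _) x).mp hx
  clear hx
  induction y with
  | zero => simp
  | add y z hy hz =>
    rw [map_add]
    exact add_mem hy hz
  | tmul m p =>
    obtain ⟨p, hp⟩ := p
    simp only [LinearMap.lTensor_tmul, Submodule.subtype_apply]
    induction hp using Submodule.smul_induction_on' with
    | smul a ha q _ =>
      rw [TensorProduct.tmul_smul, ← algebraMap_smul B a]
      exact Submodule.smul_mem_smul (Ideal.mem_map_of_mem _ ha) trivial
    | add p _ q _ hp hq => rw [TensorProduct.tmul_add]; exact add_mem hp hq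

/-- If `M → N → C → 0` is exact with `N` flat, and `M ⊗ A/I → N ⊗ A/I` is injective for every
ideal `I`, then `C` is flat. -/
theorem Module.Flat.of_exact_of_rTensor_quotient_injective
    {A M N C : Type*} [CommRing A]
    [AddCommGroup M] [Module A M] [AddCommGroup N] [Module A N] [Module.Flat A N]
    [AddCommGroup C] [Module A C] {f : M →ₗ[A] N} {g : N →ₗ[A] C}
    (hexact : Function.Exact f g) (hg : Function.Surjective g)
    (hf : ∀ I : Ideal A, Function.Injective (f.rTensor (A ⧸ I))) : Module.Flat A C :=
  Module.Flat.iff_lTensor_injective'.mpr fun I ↦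
    lTensor_injective_of_exact_of_exact_of_rTensor_injective hexact hg
      (LinearMap.exact_subtype_mkQ I) (Submodule.mkQ_surjective _) (hf I)
      (Module.Flat.lTensor_preserves_injective_linearMap _ Subtype.val_injective)

namespace IsLocalRing

/-- If `u ⊗ k` is injective and the target of `u` is flat over `A`, then `u ⊗ P` is injective for
every finitely generated `A`-module `P`. -/
theorem rTensor_injective_of_lTensor_residueField_injective
    {A B M N P : Type*} [CommRing A] [CommRing B] [IsNoetherianRing B]
    [IsLocalRing A] [IsLocalRing B] [Algebra A B] [IsLocalHom (algebraMap A B)]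
    [AddCommGroup M] [Module A M] [Module B M] [IsScalarTower A B M] [Module.Finite B M]
    [AddCommGroup N] [Module A N] [Module.Flat A N]
    [AddCommGroup P] [Module A P] [Module.Finite A P]
    (u : M →ₗ[A] N) (hu : Function.Injective (u.lTensor (ResidueField A))) :
    Function.Injective (u.rTensor P) := by
  rw [injective_iff_map_eq_zero]
  intro x hx
  have := Module.Finite.tensorProduct_restrictScalars A B M P
  have hne : (maximalIdeal A).map (algebraMap A B) ≠ ⊤ :=
    ne_top_of_le_ne_top (maximalIdeal.isMaximal B).ne_top
      (((local_hom_TFAE (algebraMap A B)).out 0 2).mp ‹_›)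
  rw [← Submodule.mem_bot B, ← Ideal.iInf_pow_smul_eq_bot_of_isLocalRing _ hne,
    Submodule.mem_iInf]
  intro n
  rw [← Ideal.map_pow]
  apply TensorProduct.mem_map_smul_top_of_lTensor_mkQ_eq_zero
  have hn : Function.Injective
      (u.rTensor (P ⧸ (maximalIdeal A ^ n • ⊤ : Submodule A P))) := by
    rw [← LinearMap.lTensor_inj_iff_rTensor_inj]
    refine lTensor_injective_of_maximalIdeal_pow_smul_eq_zero u hu n fun a ha p ↦ ?_
    obtain ⟨p, rfl⟩ := Submodule.mkQ_surjective _ p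
    rw [← map_smul, Submodule.mkQ_apply, Submodule.Quotient.mk_eq_zero]
    exact Submodule.smul_mem_smul ha trivial
  apply hn
  rw [map_zero, ← LinearMap.comp_apply, LinearMap.rTensor_comp_lTensor,
    ← LinearMap.lTensor_comp_rTensor, LinearMap.comp_apply, hx, map_zero]

/-- The fibre criterion for an exact sequence `M → N → C → 0` over a local ring `A`, with `N`
flat over `A` and `M` finite over a Noetherian local `A`-algebra. -/
theorem injective_and_flat_iff_lTensor_residueField_injective
    {A B M N C : Type*} [CommRing A] [CommRing B] [IsNoetherianRing B]
    [IsLocalRing A] [IsLocalRing B] [Algebra A B] [IsLocalHom (algebraMap A B)]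
    [AddCommGroup M] [Module A M] [Module B M] [IsScalarTower A B M] [Module.Finite B M]
    [AddCommGroup N] [Module A N] [Module.Flat A N] [AddCommGroup C] [Module A C]
    {u : M →ₗ[A] N} {g : N →ₗ[A] C} (hexact : Function.Exact u g) (hg : Function.Surjective g) :
    (Function.Injective u ∧ Module.Flat A C) ↔
      Function.Injective (u.lTensor (ResidueField A)) := by
  constructor
  · rintro ⟨hinj, hflat⟩
    have hres : Function.Exact (maximalIdeal A).subtype
        (Algebra.linearMap A (ResidueField A)) := fun a ↦ by
      simp [ResidueField.algebraMap_eq]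
    exact lTensor_injective_of_exact_of_exact_of_rTensor_injective
      hres residue_surjective hexact hg
      (Module.Flat.rTensor_preserves_injective_linearMap _ Subtype.val_injective)
      (Module.Flat.lTensor_preserves_injective_linearMap _ hinj)
  · intro hu
    refine ⟨fun x y hxy ↦ ?_,
      .of_exact_of_rTensor_quotient_injective hexact hg fun I ↦
        rTensor_injective_of_lTensor_residueField_injective (B := B) u hu⟩
    have h := rTensor_injective_of_lTensor_residueField_injective (B := B) (P := A) u hu
    apply (TensorProduct.rid A M).symm.injective
    apply h
    simp [hxy]

end IsLocalRing

theorem stmt0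
    {A B M N : Type*} [CommRing A] [CommRing B]
    [IsNoetherianRing A] [IsNoetherianRing B]
    [IsLocalRing A] [IsLocalRing B]
    [Algebra A B] [IsLocalHom (algebraMap A B)]
    [AddCommGroup M] [Module A M] [Module B M] [IsScalarTower A B M]
    [AddCommGroup N] [Module A N] [Module B N] [IsScalarTower A B N]
    [Module.Finite B M] [Module.Finite B N]
    [Module.Flat A N]
    (u : M →ₗ[B] N) :
    (Function.Injective u ∧ Module.Flat A (N ⧸ LinearMap.range u)) ↔
      Function.Injective
        (LinearMap.lTensor (ResidueField A) (u.restrictScalars A)) := by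
  exact injective_and_flat_iff_lTensor_residueField_injective (B := B)
    (u := u.restrictScalars A) (g := (LinearMap.range u).mkQ.restrictScalars A)
    u.exact_map_mkQ_range (LinearMap.range u).mkQ_surjective
end

section
/- Let A → B → C be local morphisms of Noetherian local rings with B flat over A, let k be the residue field of A, and let M be a finitely generated C-module. Then M is flat over B if and only if M is flat over A and M ⊗_A k is flat over B ⊗_A k. -/
/-!
STATEMENT 1 (EGA III 10.2.5): Let `A → B → C` be local morphisms of Noetherian local
rings with `B` flat over `A`, let `k` be the residue field of `A`, and let `M` be a
finitely generated `C`-module.  Then `M` is flat over `B` iff `M` is flat over `A` and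
`M ⊗_A k` is flat over `B ⊗_A k`.

Here we use the canonical identifications `B ⊗_A k ≅ B / m_A B` and
`M ⊗_A k ≅ M / m_A M` (with `k = A/m_A` the residue field), so the fiber condition is
stated as flatness of `M ⧸ (m_A B) M` over `B ⧸ m_A B`.
-/

open IsLocalRing

open TensorProduct

section FlatnessCriterion

variable {B M : Type*} [CommRing B] [AddCommGroup M] [Module B M] (I : Ideal B)

/-- The fiber `M ⧸ I M` is flat over `B ⧸ I` iff the base change `(B ⧸ I) ⊗ M` is. -/
lemma flat_quotient_smul_top_iff :
    Module.Flat (B ⧸ I) (M ⧸ (I • (⊤ : Submodule B M))) ↔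
      Module.Flat (B ⧸ I) ((B ⧸ I) ⊗[B] M) :=
  Module.Flat.equiv_iff
    ((quotTensorEquivQuotSMul M I).extendScalarsOfSurjective Ideal.Quotient.mk_surjective).symm

/-- An injectivity criterion after tensoring, from a short exact sequence of sources. -/
lemma lTensor_injective_of_exact {K₁ K₂ K₃ N₂ N₃ : Type*}
    [AddCommGroup K₁] [AddCommGroup K₂] [AddCommGroup K₃] [AddCommGroup N₂] [AddCommGroup N₃]
    [Module B K₁] [Module B K₂] [Module B K₃] [Module B N₂] [Module B N₃]
    {f₁ : K₁ →ₗ[B] K₂} {f₂ : K₂ →ₗ[B] K₃} {g : N₂ →ₗ[B] N₃} {i₂ : K₂ →ₗ[B] N₂} {i₃ : K₃ →ₗ[B] N₃}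
    (hf : Function.Exact f₁ f₂) (hf₂ : Function.Surjective f₂) (comm : g ∘ₗ i₂ = i₃ ∘ₗ f₂)
    (h₁ : Function.Injective ((i₂ ∘ₗ f₁).lTensor M)) (h₃ : Function.Injective (i₃.lTensor M)) :
    Function.Injective (i₂.lTensor M) := by
  rw [injective_iff_map_eq_zero]
  intro x hx
  have hx₃ : f₂.lTensor M x = 0 := by
    apply h₃
    rw [map_zero, ← LinearMap.lTensor_comp_apply, ← comm, LinearMap.lTensor_comp_apply, hx,
      map_zero]
  obtain ⟨y, rfl⟩ := (lTensor_exact M hf hf₂ x).mp hx₃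
  rw [← LinearMap.lTensor_comp_apply] at hx
  rw [h₁ (hx.trans (map_zero _).symm), map_zero]

variable {I}

lemma lTensor_injective_of_flat_quotient
    [Module.Flat (B ⧸ I) (M ⧸ (I • (⊤ : Submodule B M)))]
    {N N' : Type*} [AddCommGroup N] [AddCommGroup N'] [Module B N] [Module B N']
    (f : N' →ₗ[B] N) (hf : Function.Injective f) (hN : ∀ a ∈ I, ∀ x : N, a • x = 0) :
    Function.Injective (f.lTensor M) := by
  have := (flat_quotient_smul_top_iff (M := M) I).mp inferInstance
  have tors : Module.IsTorsionBySet B N I := fun x a ↦ hN a a.2 x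
  have tors' : Module.IsTorsionBySet B N' I := fun x a ↦ hf (by simpa using hN a a.2 (f x))
  let := tors.module
  let := tors'.module
  have : IsScalarTower B (B ⧸ I) N := tors.isScalarTower
  have : IsScalarTower B (B ⧸ I) N' := tors'.isScalarTower
  let g : N' →ₗ[B ⧸ I] N := f.extendScalarsOfSurjective Ideal.Quotient.mk_surjective
  have hg : Function.Injective (g.rTensor ((B ⧸ I) ⊗[B] M)) :=
    Module.Flat.rTensor_preserves_injective_linearMap g hf
  let e := AlgebraTensorModule.cancelBaseChange B (B ⧸ I) (B ⧸ I) N M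
  let e' := AlgebraTensorModule.cancelBaseChange B (B ⧸ I) (B ⧸ I) N' M
  have comm : f.rTensor M =
      (e.toLinearMap ∘ₗ g.rTensor _ ∘ₗ e'.symm.toLinearMap).restrictScalars B := by
    ext x m
    simp [e, e', g]
  rw [LinearMap.lTensor_inj_iff_rTensor_inj, comm]
  exact e.injective.comp (hg.comp e'.symm.injective)

lemma lTensor_subtype_injective_of_flat (hI : Function.Injective (I.subtype.lTensor M))
    [Module.Flat (B ⧸ I) (M ⧸ (I • (⊤ : Submodule B M)))] {F : Type*}
    [AddCommGroup F] [Module B F] [Module.Flat B F]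
    (L : Submodule B F) (hL : ∀ a ∈ I, ∀ x : F, a • x ∈ L) :
    Function.Injective (L.subtype.lTensor M) := by
  let μ : I ⊗[B] F →ₗ[B] F := (TensorProduct.lid B F).toLinearMap ∘ₗ I.subtype.rTensor F
  have hμ : Function.Injective (μ.lTensor M) := by
    have assoc : (I.subtype.rTensor F).lTensor M ∘ₗ (TensorProduct.assoc B M I F).toLinearMap =
        (TensorProduct.assoc B M B F).toLinearMap ∘ₗ (I.subtype.lTensor M).rTensor F :=
      TensorProduct.ext_threefold fun _ _ _ ↦ rfl
    have inj : Function.Injective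
        ((I.subtype.rTensor F).lTensor M ∘ₗ (TensorProduct.assoc B M I F).toLinearMap) := by
      rw [assoc]
      exact (TensorProduct.assoc B M B F).injective.comp
        (Module.Flat.rTensor_preserves_injective_linearMap _ hI)
    rw [LinearMap.lTensor_comp]
    exact ((TensorProduct.lid B F).lTensor M).injective.comp
      (Function.Injective.of_comp_right inj (TensorProduct.assoc B M I F).surjective)
  have mem (t : I ⊗[B] F) : μ t ∈ L := by
    induction t with
    | zero => simp
    | add s t hs ht => rw [map_add]; exact L.add_mem hs ht
    | tmul a x => exact hL a a.2 x
  let f₁ : I ⊗[B] F →ₗ[B] L := μ.codRestrict L mem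
  let P : Submodule B F := LinearMap.range μ
  have ker : LinearMap.range f₁ = LinearMap.ker (P.mkQ ∘ₗ L.subtype) := by
    rw [LinearMap.ker_comp, Submodule.ker_mkQ, LinearMap.range_codRestrict]
  refine lTensor_injective_of_exact (f₁ := f₁) (f₂ := (LinearMap.range f₁).mkQ) (g := P.mkQ)
    (i₃ := (LinearMap.range f₁).liftQ (P.mkQ ∘ₗ L.subtype) ker.le)
    (LinearMap.exact_map_mkQ_range f₁) (Submodule.mkQ_surjective _)
    (Submodule.liftQ_mkQ _ _ _).symm hμ
    (lTensor_injective_of_flat_quotient (I := I) _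
      (LinearMap.ker_eq_bot.mp (Submodule.ker_liftQ_eq_bot _ _ _ ker.ge)) fun a ha x ↦ ?_)
  obtain ⟨y, rfl⟩ := P.mkQ_surjective x
  rw [← map_smul]
  exact (Submodule.Quotient.mk_eq_zero P).mpr ⟨⟨a, ha⟩ ⊗ₜ y, rfl⟩

lemma lTensor_subtype_injective_of_surjective (hI : Function.Injective (I.subtype.lTensor M))
    [Module.Flat (B ⧸ I) (M ⧸ (I • (⊤ : Submodule B M)))] {F N : Type*}
    [AddCommGroup F] [Module B F] [Module.Flat B F] [AddCommGroup N] [Module B N]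
    (π : F →ₗ[B] N) (hπ : Function.Surjective π)
    (K : Submodule B N) (hK : ∀ a ∈ I, ∀ x : N, a • x ∈ K) :
    Function.Injective (K.subtype.lTensor M) := by
  let L := K.comap π
  have hL : LinearMap.ker π ≤ L := LinearMap.ker_le_comap π
  let ι : LinearMap.ker π →ₗ[B] L := Submodule.inclusion hL
  let p : L →ₗ[B] K := π.restrict fun _ h ↦ h
  have hp : Function.Surjective p := fun ⟨y, hy⟩ ↦ by
    obtain ⟨x, rfl⟩ := hπ y
    exact ⟨⟨x, hy⟩, rfl⟩
  have hιp : Function.Exact ι p := fun x ↦ by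
    constructor
    · intro hx
      exact ⟨⟨x.1, congrArg Subtype.val hx⟩, rfl⟩
    · rintro ⟨y, rfl⟩
      exact Subtype.ext y.2
  have hι : L.subtype ∘ₗ ι = (LinearMap.ker π).subtype := Submodule.subtype_comp_inclusion _ _ hL
  have hKp : K.subtype ∘ₗ p = π ∘ₗ L.subtype := rfl
  have hLF : Function.Injective (L.subtype.lTensor M) :=
    lTensor_subtype_injective_of_flat hI L fun a ha x ↦ by simpa [L] using hK a ha (π x)
  exact LinearMap.injective_of_surjective_of_injective_of_right_exact
    (ι.lTensor M) (p.lTensor M) ((LinearMap.ker π).subtype.lTensor M) (π.lTensor M)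
    LinearMap.id (L.subtype.lTensor M) (K.subtype.lTensor M)
    (by rw [← LinearMap.lTensor_comp, hι, LinearMap.comp_id])
    (by rw [← LinearMap.lTensor_comp, ← LinearMap.lTensor_comp, hKp])
    (lTensor_exact M hιp hp) (lTensor_exact M (LinearMap.exact_subtype_ker_map π) hπ)
    Function.surjective_id hLF (LinearMap.lTensor_surjective M hp)

/-- If `I ⊗ M → M` is injective and `M ⧸ I M` is flat over `B ⧸ I`, then tensoring with `M`
preserves injectivity of every inclusion whose cokernel is killed by `I`. -/
lemma lTensor_subtype_injective_of_smul_mem (hI : Function.Injective (I.subtype.lTensor M))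
    [Module.Flat (B ⧸ I) (M ⧸ (I • (⊤ : Submodule B M)))] {N : Type*}
    [AddCommGroup N] [Module B N] (K : Submodule B N) (hK : ∀ a ∈ I, ∀ x : N, a • x ∈ K) :
    Function.Injective (K.subtype.lTensor M) := by
  exact lTensor_subtype_injective_of_surjective hI (Finsupp.linearCombination B id)
    (Finsupp.linearCombination_id_surjective B N) K hK

lemma lTensor_injective_of_pow_smul_eq_zero (hI : Function.Injective (I.subtype.lTensor M))
    [Module.Flat (B ⧸ I) (M ⧸ (I • (⊤ : Submodule B M)))] (n : ℕ) {N N' : Type*}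
    [AddCommGroup N] [AddCommGroup N'] [Module B N] [Module B N'] (f : N' →ₗ[B] N)
    (hf : Function.Injective f) (hN : ∀ a ∈ I ^ n, ∀ x : N, a • x = 0) :
    Function.Injective (f.lTensor M) := by
  induction n generalizing N N' with
  | zero =>
    exact lTensor_injective_of_flat_quotient (I := I) f hf fun a _ x ↦ hN a (by simp) x
  | succ n ih =>
    let P : Submodule B N := I • ⊤
    let f' : P.comap f →ₗ[B] P := f.restrict fun _ h ↦ h
    have hf' : Function.Injective f' := fun x y h ↦ Subtype.ext (hf (congrArg Subtype.val h))
    have hP : ∀ a ∈ I ^ n, ∀ x : P, a • x = 0 := by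
      rintro a ha ⟨x, hx⟩
      apply Subtype.ext
      change a • x = 0
      refine Submodule.smul_induction_on hx (fun b hb y _ ↦ ?_) fun y z hy hz ↦ ?_
      · rw [smul_smul]
        exact hN _ (pow_succ I n ▸ Ideal.mul_mem_mul ha hb) y
      · rw [smul_add, hy, hz, add_zero]
    have comp : f ∘ₗ (P.comap f).subtype = P.subtype ∘ₗ f' := rfl
    refine lTensor_injective_of_exact (f₁ := (P.comap f).subtype) (f₂ := (P.comap f).mkQ)
      (g := P.mkQ) (i₃ := (P.comap f).mapQ P f le_rfl) (LinearMap.exact_subtype_mkQ _)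
      (Submodule.mkQ_surjective _) (by ext; rfl) ?_
      (lTensor_injective_of_flat_quotient (I := I) _ ?_ fun a ha x ↦ ?_)
    · rw [comp, LinearMap.lTensor_comp]
      exact (lTensor_subtype_injective_of_smul_mem hI P fun a ha x ↦
        Submodule.smul_mem_smul ha trivial).comp (ih f' hf' hP)
    · rw [← LinearMap.ker_eq_bot]
      exact Submodule.ker_liftQ_eq_bot _ _ _ (by rw [LinearMap.ker_comp, Submodule.ker_mkQ])
    · obtain ⟨y, rfl⟩ := P.mkQ_surjective x
      rw [← map_smul]
      exact (Submodule.Quotient.mk_eq_zero P).mpr (Submodule.smul_mem_smul ha trivial)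

/-- The local criterion of flatness for a finite module over a Noetherian local `B`-algebra. -/
theorem flat_of_lTensor_subtype_injective [IsNoetherianRing B]
    {C : Type*} [CommRing C] [IsNoetherianRing C] [IsLocalRing C] [Algebra B C] [Module C M]
    [IsScalarTower B C M] [Module.Finite C M] (hIC : I.map (algebraMap B C) ≠ ⊤)
    (hI : Function.Injective (I.subtype.lTensor M))
    [Module.Flat (B ⧸ I) (M ⧸ (I • (⊤ : Submodule B M)))] : Module.Flat B M := by
  rw [Module.Flat.iff_lTensor_injective']
  intro J
  have : Module.Finite C (M ⊗[B] J) :=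
    Module.Finite.equiv (AlgebraTensorModule.cancelBaseChange B C C M J)
  obtain ⟨k, hk⟩ := I.exists_pow_inf_eq_pow_smul J
  rw [injective_iff_map_eq_zero]
  intro x hx
  rw [← Submodule.mem_bot C, ← Ideal.iInf_pow_smul_eq_bot_of_isLocalRing _ hIC, Submodule.mem_iInf]
  intro n
  let P : Ideal B := I ^ (n + k)
  let q : (J ⧸ Submodule.comap J.subtype P) →ₗ[B] B ⧸ P :=
    (Submodule.comap J.subtype P).mapQ P J.subtype le_rfl
  have hq : Function.Injective (q.lTensor M) := by
    refine lTensor_injective_of_pow_smul_eq_zero hI (n + k) q ?_ fun a ha x ↦ ?_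
    · rw [← LinearMap.ker_eq_bot]
      exact Submodule.ker_liftQ_eq_bot _ _ _ (by rw [LinearMap.ker_comp, Submodule.ker_mkQ])
    · obtain ⟨b, rfl⟩ := Ideal.Quotient.mk_surjective x
      exact Ideal.Quotient.eq_zero_iff_mem.mpr (P.mul_mem_right b ha)
  have hx' : (Submodule.comap J.subtype P).mkQ.lTensor M x = 0 := by
    apply hq
    have comm : q ∘ₗ (Submodule.comap J.subtype P).mkQ = P.mkQ ∘ₗ J.subtype := by ext; rfl
    rw [map_zero, ← LinearMap.lTensor_comp_apply, comm, LinearMap.lTensor_comp_apply, hx, map_zero]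
  obtain ⟨y, rfl⟩ := (lTensor_exact M (LinearMap.exact_subtype_mkQ _)
    (Submodule.mkQ_surjective _) x).mp hx'
  have hPJ : Submodule.comap J.subtype P ≤ I ^ n • (⊤ : Submodule B J) := by
    rw [← Submodule.map_le_map_iff_of_injective J.injective_subtype, Submodule.map_smul'',
      Submodule.map_subtype_top]
    rintro _ ⟨j, hj, rfl⟩
    have hj' : (j : B) ∈ I ^ (n + k) • (⊤ : Submodule B B) ⊓ J := ⟨by simpa using hj, j.2⟩
    rw [hk _ (Nat.le_add_left k n), Nat.add_sub_cancel] at hj'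
    exact Submodule.smul_mono le_rfl inf_le_right hj'
  have tmul_mem (m : M) (j : J) (hj : j ∈ I ^ n • (⊤ : Submodule B J)) :
      m ⊗ₜ[B] j ∈ I.map (algebraMap B C) ^ n • (⊤ : Submodule C (M ⊗[B] J)) := by
    refine Submodule.smul_induction_on hj (fun a ha j _ ↦ ?_) fun j j' hj hj' ↦ ?_
    · rw [tmul_smul, ← algebraMap_smul C a, ← Ideal.map_pow]
      exact Submodule.smul_mem_smul (Ideal.mem_map_of_mem _ ha) trivial
    · rw [tmul_add]
      exact add_mem hj hj'
  clear hx hx'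
  induction y with
  | zero => simp
  | tmul m j => exact tmul_mem m j (hPJ j.2)
  | add y z hy hz => rw [map_add]; exact add_mem hy hz

end FlatnessCriterion

/-- If `M` is flat over `A`, then `𝔞B ⊗ M → M` is injective for every ideal `𝔞` of `A`. -/
lemma lTensor_subtype_map_injective {A B M : Type*} [CommRing A] [CommRing B] [Algebra A B]
    [AddCommGroup M] [Module A M] [Module B M] [IsScalarTower A B M] [Module.Flat A M]
    (𝔞 : Ideal A) :
    Function.Injective ((𝔞.map (algebraMap A B)).subtype.lTensor M) := by
  let ι : 𝔞 →ₗ[A] 𝔞.map (algebraMap A B) :=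
    ((Algebra.linearMap A B).restrict (p := 𝔞)
      (q := (𝔞.map (algebraMap A B)).restrictScalars A) fun _ ha ↦ Ideal.mem_map_of_mem _ ha)
  let φ : M ⊗[A] 𝔞 →ₗ[A] M ⊗[B] 𝔞.map (algebraMap A B) :=
    TensorProduct.mapOfCompatibleSMul B A A M _ ∘ₗ ι.lTensor M
  have φ_tmul (m : M) (a : 𝔞) : φ (m ⊗ₜ a) = m ⊗ₜ ι a := rfl
  have φ_surj : Function.Surjective φ := by
    rw [← LinearMap.range_eq_top, eq_top_iff]
    rintro x -
    induction x with
    | zero => exact zero_mem _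
    | add x y hx hy => exact add_mem hx hy
    | tmul m j =>
      obtain ⟨j, hj⟩ := j
      induction hj using Submodule.span_induction generalizing m with
      | mem b hb =>
        obtain ⟨a, ha, rfl⟩ := hb
        exact ⟨m ⊗ₜ ⟨a, ha⟩, rfl⟩
      | zero => exact ⟨0, by rw [map_zero]; exact (tmul_zero _ m).symm⟩
      | add b c hb hc ihb ihc =>
        have := add_mem (ihb m) (ihc m)
        rwa [← tmul_add] at this
      | smul r b hb ih =>
        have := ih (r • m)
        rwa [smul_tmul] at this
  have comm (t : M ⊗[A] 𝔞) :
      TensorProduct.rid B M ((𝔞.map (algebraMap A B)).subtype.lTensor M (φ t)) =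
        TensorProduct.rid A M (𝔞.subtype.lTensor M t) := by
    induction t with
    | zero => simp
    | add s t hs ht => simp only [map_add, hs, ht]
    | tmul m a =>
      rw [φ_tmul, LinearMap.lTensor_tmul, LinearMap.lTensor_tmul, rid_tmul, rid_tmul]
      exact algebraMap_smul B (a : A) m
  rw [injective_iff_map_eq_zero]
  intro x hx
  obtain ⟨t, rfl⟩ := φ_surj x
  have ht := comm t
  rw [hx, map_zero, eq_comm, LinearEquiv.map_eq_zero_iff] at ht
  rw [Module.Flat.lTensor_preserves_injective_linearMap _ 𝔞.injective_subtype
    (ht.trans (map_zero _).symm), map_zero]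

theorem stmt1
    {A B C M : Type*} [CommRing A] [CommRing B] [CommRing C]
    [IsNoetherianRing A] [IsNoetherianRing B] [IsNoetherianRing C]
    [IsLocalRing A] [IsLocalRing B] [IsLocalRing C]
    [Algebra A B] [Algebra B C] [Algebra A C] [IsScalarTower A B C]
    [IsLocalHom (algebraMap A B)] [IsLocalHom (algebraMap B C)]
    [AddCommGroup M] [Module A M] [Module B M] [Module C M]
    [IsScalarTower A B M] [IsScalarTower B C M] [IsScalarTower A C M]
    [Module.Finite C M] [Module.Flat A B] :
    Module.Flat B M ↔
      (Module.Flat A M ∧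
        Module.Flat (B ⧸ (maximalIdeal A).map (algebraMap A B))
          (M ⧸ ((maximalIdeal A).map (algebraMap A B) • (⊤ : Submodule B M)))) := by
  constructor
  · intro _
    exact ⟨Module.Flat.trans A B M, (flat_quotient_smul_top_iff _).mpr inferInstance⟩
  · rintro ⟨_, _⟩
    have hAB : (maximalIdeal A).map (algebraMap A B) ≤ maximalIdeal B :=
      ((local_hom_TFAE (algebraMap A B)).out 0 2).mp ‹_›
    have hBC : (maximalIdeal B).map (algebraMap B C) ≤ maximalIdeal C :=
      ((local_hom_TFAE (algebraMap B C)).out 0 2).mp ‹_›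
    exact flat_of_lTensor_subtype_injective (C := C)
      (ne_top_of_le_ne_top (maximalIdeal.isMaximal C).ne_top ((Ideal.map_mono hAB).trans hBC))
      (lTensor_subtype_map_injective (maximalIdeal A))
end
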